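/- Let A be a discrete 1-form and Φ an r-form (r = 0, 1 or 2) on the combinatorial N×M torus such that both d_A^cΦ and δ_A^cΦ are su(2)-valued. Then Δ_A^cΦ = 0 if and only if δ_A^cΦ = 0 and d_A^cΦ = 0, where Δ_A^c = d_A^c δ_A^c + δ_A^c d_A^c. -/

import Mathlib

open Matrix BigOperators

noncomputable section

/-- 2×2 complex matrices. -/
abbrev Mat : Type := Matrix (Fin 2) (Fin 2) ℂ

/-- A discrete 0-form on the combinatorial N×M torus. -/
abbrev Form0 (N M : ℕ) : Type := ZMod N → ZMod M → Mat
/-- A discrete 1-form (pair of component families). -/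
abbrev Form1 (N M : ℕ) : Type := Form0 N M × Form0 N M
/-- A discrete 2-form. -/
abbrev Form2 (N M : ℕ) : Type := ZMod N → ZMod M → Mat

variable {N M : ℕ}

/-- Coboundary on 0-forms. -/
def d0 (Φ : Form0 N M) : Form1 N M :=
  (fun k s => Φ (k + 1) s - Φ k s, fun k s => Φ k (s + 1) - Φ k s)

/-- Coboundary on 1-forms. -/
def d1 (Ω : Form1 N M) : Form2 N M :=
  fun k s => Ω.2 (k + 1) s - Ω.2 k s - Ω.1 k (s + 1) + Ω.1 k s

/-- Cup product of two 0-forms. -/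
def cup00 (Φ Ψ : Form0 N M) : Form0 N M := fun k s => Φ k s * Ψ k s

/-- Cup product of a 0-form and a 1-form. -/
def cup01 (Φ : Form0 N M) (Ω : Form1 N M) : Form1 N M :=
  (fun k s => Φ k s * Ω.1 k s, fun k s => Φ k s * Ω.2 k s)

/-- Cup product of a 1-form and a 0-form. -/
def cup10 (Ω : Form1 N M) (Φ : Form0 N M) : Form1 N M :=
  (fun k s => Ω.1 k s * Φ (k + 1) s, fun k s => Ω.2 k s * Φ k (s + 1))

/-- Cup product of a 0-form and a 2-form. -/
def cup02 (Φ : Form0 N M) (Ψ : Form2 N M) : Form2 N M := fun k s => Φ k s * Ψ k s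

/-- Cup product of a 2-form and a 0-form. -/
def cup20 (Ψ : Form2 N M) (Φ : Form0 N M) : Form2 N M :=
  fun k s => Ψ k s * Φ (k + 1) (s + 1)

/-- Cup product of two 1-forms. -/
def cup11 (Ω Θ : Form1 N M) : Form2 N M :=
  fun k s => Ω.1 k s * Θ.2 (k + 1) s - Ω.2 k s * Θ.1 k (s + 1)

/-- Star operator on 0-forms. -/
def star0 (Φ : Form0 N M) : Form2 N M := fun k s => Φ k s

/-- Star operator on 1-forms. -/
def star1 (Ω : Form1 N M) : Form1 N M :=
  (fun k s => -Ω.2 k (s - 1), fun k s => Ω.1 (k - 1) s)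

/-- Star operator on 2-forms. -/
def star2 (Ψ : Form2 N M) : Form0 N M := fun k s => Ψ (k - 1) (s - 1)

/-- Inverse star, taking 0-forms to 2-forms (inverse of `star2`). -/
def starInv0 (Φ : Form0 N M) : Form2 N M := fun k s => Φ (k + 1) (s + 1)

/-- Inverse star on 1-forms (inverse of `star1`). -/
def starInv1 (Ω : Form1 N M) : Form1 N M :=
  (fun k s => Ω.2 (k + 1) s, fun k s => -Ω.1 k (s + 1))

/-- Inverse star, taking 2-forms to 0-forms (inverse of `star0`). -/
def starInv2 (Ψ : Form2 N M) : Form0 N M := fun k s => Ψ k s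

/-- Codifferential on 1-forms. -/
def delta1 (Ω : Form1 N M) : Form0 N M :=
  fun k s => Ω.1 (k - 1) s - Ω.1 k s + Ω.2 k (s - 1) - Ω.2 k s

/-- Codifferential on 2-forms. -/
def delta2 (Ψ : Form2 N M) : Form1 N M :=
  (fun k s => Ψ k s - Ψ k (s - 1), fun k s => -(Ψ k s - Ψ (k - 1) s))

/-- Covariant exterior derivative on 0-forms: `d_A Φ = dΦ + A∪Φ − Φ∪A`. -/
def dA0 (A : Form1 N M) (Φ : Form0 N M) : Form1 N M :=
  d0 Φ + cup10 A Φ - cup01 Φ A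

/-- Covariant exterior derivative on 1-forms: `d_A Ω = dΩ + A∪Ω + Ω∪A`. -/
def dA1 (A : Form1 N M) (Ω : Form1 N M) : Form2 N M :=
  d1 Ω + cup11 A Ω + cup11 Ω A

/-- Adjoint covariant derivative on 1-forms:
`δ_A Ω = δΩ + ∗⁻¹(∗Ω ∪ ∗∗A − A ∪ ∗Ω)`. -/
def deltaA1 (A : Form1 N M) (Ω : Form1 N M) : Form0 N M :=
  delta1 Ω + starInv2 (cup11 (star1 Ω) (star1 (star1 A)) - cup11 A (star1 Ω))

/-- Adjoint covariant derivative on 2-forms: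
`δ_A Ψ = δΨ + ∗⁻¹(∗Ψ ∪ ∗∗A + A ∪ ∗Ψ)`. -/
def deltaA2 (A : Form1 N M) (Ψ : Form2 N M) : Form1 N M :=
  delta2 Ψ + starInv1 (cup01 (star2 Ψ) (star1 (star1 A)) + cup10 A (star2 Ψ))

/-- Covariant Laplacian on 0-forms (`δ_A` vanishes on 0-forms). -/
def lapA0 (A : Form1 N M) (Φ : Form0 N M) : Form0 N M := deltaA1 A (dA0 A Φ)

/-- Covariant Laplacian on 1-forms. -/
def lapA1 (A : Form1 N M) (Ω : Form1 N M) : Form1 N M :=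
  dA0 A (deltaA1 A Ω) + deltaA2 A (dA1 A Ω)

/-- Covariant Laplacian on 2-forms (`d_A` of a 2-form is a 3-form, hence zero). -/
def lapA2 (A : Form1 N M) (Ψ : Form2 N M) : Form2 N M := dA1 A (deltaA2 A Ψ)

/-- Discrete curvature of a 1-form `A`. -/
def curv (A : Form1 N M) : Form2 N M :=
  fun k s => A.2 (k + 1) s - A.2 k s - A.1 k (s + 1) + A.1 k s
    + A.1 k s * A.2 (k + 1) s - A.2 k s * A.1 k (s + 1)

/-- Inner product of 0-forms over the torus. -/
def inner0 [NeZero N] [NeZero M] (Φ Ω : Form0 N M) : ℂ :=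
  -(1 / 2) * ∑ k : ZMod N, ∑ s : ZMod M, Matrix.trace (Φ k s * Ω k s)

/-- Inner product of 1-forms over the torus. -/
def inner1 [NeZero N] [NeZero M] (Φ Ω : Form1 N M) : ℂ :=
  -(1 / 2) * ∑ k : ZMod N, ∑ s : ZMod M,
    Matrix.trace (Φ.1 k s * Ω.1 k s + Φ.2 k s * Ω.2 k s)

/-- Inner product of 2-forms over the torus. -/
def inner2 [NeZero N] [NeZero M] (Φ Ω : Form2 N M) : ℂ :=
  -(1 / 2) * ∑ k : ZMod N, ∑ s : ZMod M, Matrix.trace (Φ k s * Ω k s)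

/-- Pairing of a 2-form with the fundamental chain `V`: `⟨V,Ψ⟩ = Σ Ψ_{k,s}`. -/
def pairV [NeZero N] [NeZero M] (Ψ : Form2 N M) : Mat :=
  ∑ k : ZMod N, ∑ s : ZMod M, Ψ k s

/-- A matrix lies in su(2): traceless and skew-Hermitian. -/
def IsSU2 (X : Mat) : Prop := Matrix.trace X = 0 ∧ Xᴴ = -X

/-- An su(2)-valued 0-form (or 2-form). -/
def IsSU2Form0 (Φ : Form0 N M) : Prop := ∀ k s, IsSU2 (Φ k s)

/-- An su(2)-valued 1-form. -/
def IsSU2Form1 (Ω : Form1 N M) : Prop := ∀ k s, IsSU2 (Ω.1 k s) ∧ IsSU2 (Ω.2 k s)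

open scoped ComplexOrder

section Torus

variable [NeZero N] [NeZero M]

/-- Discrete divergences sum to zero over the torus. -/
lemma sum_torus_eq_of_sub_eq_divergence {F G f g : ZMod N → ZMod M → ℂ}
    (h : ∀ k s, F k s - G k s = (f k s - f (k - 1) s) + (g k s - g k (s - 1))) :
    ∑ k, ∑ s, F k s = ∑ k, ∑ s, G k s := by
  have hf : ∑ k, ∑ s, f (k - 1) s = ∑ k, ∑ s, f k s :=
    (Equiv.subRight (1 : ZMod N)).sum_comp fun k => ∑ s, f k s
  have hg : ∑ k, ∑ s, g k (s - 1) = ∑ k, ∑ s, g k s :=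
    Finset.sum_congr rfl fun k _ => (Equiv.subRight (1 : ZMod M)).sum_comp (g k)
  have hsum : ∑ k, ∑ s, (F k s - G k s) = 0 := by
    simp only [h, Finset.sum_add_distrib, Finset.sum_sub_distrib, hf, hg, sub_self, add_zero]
  simpa only [Finset.sum_sub_distrib, sub_eq_zero] using hsum

/-- `δ_A` is adjoint to `d_A` between 0-forms and 1-forms. -/
lemma inner1_dA0_left (A Ω : Form1 N M) (Φ : Form0 N M) :
    inner1 (dA0 A Φ) Ω = inner0 Φ (deltaA1 A Ω) := by
  unfold inner1 inner0
  congr 1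
  refine sum_torus_eq_of_sub_eq_divergence
    (f := fun k s => trace (Φ (k + 1) s * (Ω.1 k s * (1 + A.1 k s))))
    (g := fun k s => trace (Φ k (s + 1) * (Ω.2 k s * (1 + A.2 k s)))) fun k s => ?_
  simp [dA0, deltaA1, d0, delta1, cup10, cup01, cup11, star1, starInv2, trace_fin_two,
    Matrix.mul_apply, Fin.sum_univ_two]
  ring

/-- `δ_A` is adjoint to `d_A` between 1-forms and 2-forms. -/
lemma inner2_dA1_left (A Ω : Form1 N M) (Ψ : Form2 N M) :
    inner2 (dA1 A Ω) Ψ = inner1 Ω (deltaA2 A Ψ) := by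
  unfold inner1 inner2
  congr 1
  refine sum_torus_eq_of_sub_eq_divergence
    (f := fun k s => trace (Ω.2 (k + 1) s * (Ψ k s * (1 + A.1 k s))))
    (g := fun k s => -trace (Ω.1 k (s + 1) * (Ψ k s * (1 + A.2 k s)))) fun k s => ?_
  simp [dA1, deltaA2, d1, delta2, cup10, cup01, cup11, star1, star2, starInv1, trace_fin_two,
    Matrix.mul_apply, Fin.sum_univ_two]
  ring

lemma inner1_comm (Ω Θ : Form1 N M) : inner1 Ω Θ = inner1 Θ Ω := by
  simp only [inner1, trace_add, trace_mul_comm (Ω.1 _ _), trace_mul_comm (Ω.2 _ _)]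

lemma inner1_add_left (Ω Ω' Θ : Form1 N M) :
    inner1 (Ω + Ω') Θ = inner1 Ω Θ + inner1 Ω' Θ := by
  simp only [inner1, Prod.fst_add, Prod.snd_add, Pi.add_apply, add_mul, trace_add,
    Finset.sum_add_distrib]
  ring

@[simp] lemma inner0_zero_right (Φ : Form0 N M) : inner0 Φ 0 = 0 := by simp [inner0]

@[simp] lemma inner1_zero_left (Ω : Form1 N M) : inner1 0 Ω = 0 := by simp [inner1]

lemma IsSU2.trace_mul_self_eq {X : Mat} (hX : IsSU2 X) : trace (X * X) = -trace (Xᴴ * X) := by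
  simp [hX.2]

lemma inner0_self_eq {Φ : Form0 N M} (hΦ : IsSU2Form0 Φ) :
    inner0 Φ Φ = 1 / 2 * ∑ k, ∑ s, trace ((Φ k s)ᴴ * Φ k s) := by
  simp only [inner0, fun k s => (hΦ k s).trace_mul_self_eq, Finset.sum_neg_distrib, neg_mul_neg]

lemma inner0_self_nonneg {Φ : Form0 N M} (hΦ : IsSU2Form0 Φ) : 0 ≤ inner0 Φ Φ := by
  rw [inner0_self_eq hΦ]
  exact mul_nonneg (by norm_num [Complex.le_def]) <|
    Finset.sum_nonneg fun k _ => Finset.sum_nonneg fun s _ =>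
      (posSemidef_conjTranspose_mul_self (Φ k s)).trace_nonneg

lemma eq_zero_of_inner0_self_eq_zero {Φ : Form0 N M} (hΦ : IsSU2Form0 Φ)
    (h : inner0 Φ Φ = 0) : Φ = 0 := by
  have hnn k s : 0 ≤ trace ((Φ k s)ᴴ * Φ k s) :=
    (posSemidef_conjTranspose_mul_self (Φ k s)).trace_nonneg
  rw [inner0_self_eq hΦ, mul_eq_zero_iff_left (by norm_num),
    Finset.sum_eq_zero_iff_of_nonneg fun k _ => Finset.sum_nonneg fun s _ => hnn k s] at h
  ext1 k
  ext1 s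
  have hk := h k (Finset.mem_univ k)
  rw [Finset.sum_eq_zero_iff_of_nonneg fun s _ => hnn k s] at hk
  exact trace_conjTranspose_mul_self_eq_zero_iff.mp (hk s (Finset.mem_univ s))

lemma inner1_eq_add (Ω Θ : Form1 N M) :
    inner1 Ω Θ = inner0 Ω.1 Θ.1 + inner0 Ω.2 Θ.2 := by
  simp only [inner1, inner0, trace_add, Finset.sum_add_distrib, mul_add]

lemma eq_zero_of_inner1_self_eq_zero {Ω : Form1 N M} (hΩ : IsSU2Form1 Ω)
    (h : inner1 Ω Ω = 0) : Ω = 0 := by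
  have h₁ : IsSU2Form0 Ω.1 := fun k s => (hΩ k s).1
  have h₂ : IsSU2Form0 Ω.2 := fun k s => (hΩ k s).2
  rw [inner1_eq_add, add_eq_zero_iff_of_nonneg (inner0_self_nonneg h₁)
    (inner0_self_nonneg h₂)] at h
  exact Prod.ext (eq_zero_of_inner0_self_eq_zero h₁ h.1) (eq_zero_of_inner0_self_eq_zero h₂ h.2)

end Torus

@[simp] lemma dA0_zero (A : Form1 N M) : dA0 A 0 = 0 := by
  ext <;> simp [dA0, d0, cup10, cup01]

@[simp] lemma dA1_zero (A : Form1 N M) : dA1 A 0 = 0 := by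
  ext; simp [dA1, d1, cup11]

@[simp] lemma deltaA1_zero (A : Form1 N M) : deltaA1 A 0 = 0 := by
  ext; simp [deltaA1, delta1, cup11, star1, starInv2]

@[simp] lemma deltaA2_zero (A : Form1 N M) : deltaA2 A 0 = 0 := by
  ext <;> simp [deltaA2, delta2, cup10, cup01, star1, star2, starInv1]

/-- if `d_A^cΦ` and `δ_A^cΦ` are su(2)-valued then `Δ_A^cΦ = 0` iff
`δ_A^cΦ = 0` and `d_A^cΦ = 0` (for `r = 0` the form `δ_A^cΦ` vanishes identically and
for `r = 2` the form `d_A^cΦ` is a 3-form hence vanishes identically, so in these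
degrees the corresponding conjunct is automatic and omitted). -/
theorem discrete_covariant_harmonic_iff (N M : ℕ) [NeZero N] [NeZero M]
    (A : Form1 N M) :
    (∀ Φ : Form0 N M, IsSU2Form1 (dA0 A Φ) →
      (lapA0 A Φ = 0 ↔ dA0 A Φ = 0)) ∧
    (∀ Ω : Form1 N M, IsSU2Form0 (dA1 A Ω) → IsSU2Form0 (deltaA1 A Ω) →
      (lapA1 A Ω = 0 ↔ deltaA1 A Ω = 0 ∧ dA1 A Ω = 0)) ∧
    (∀ Ψ : Form2 N M, IsSU2Form1 (deltaA2 A Ψ) →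
      (lapA2 A Ψ = 0 ↔ deltaA2 A Ψ = 0)) := by
  refine ⟨fun Φ hd => ⟨fun h => ?_, fun h => by simp [lapA0, h]⟩,
    fun Ω hd hδ => ⟨fun h => ?_, fun h => by simp [lapA1, h.1, h.2]⟩,
    fun Ψ hδ => ⟨fun h => ?_, fun h => by simp [lapA2, h]⟩⟩
  · apply eq_zero_of_inner1_self_eq_zero hd
    rw [inner1_dA0_left, ← lapA0, h, inner0_zero_right]
  · have key : inner0 (deltaA1 A Ω) (deltaA1 A Ω) + inner0 (dA1 A Ω) (dA1 A Ω) = 0 := by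
      change _ + inner2 (dA1 A Ω) (dA1 A Ω) = 0
      rw [← inner1_dA0_left, inner2_dA1_left, inner1_comm Ω, ← inner1_add_left, ← lapA1, h,
        inner1_zero_left]
    rw [add_eq_zero_iff_of_nonneg (inner0_self_nonneg hδ) (inner0_self_nonneg hd)] at key
    exact ⟨eq_zero_of_inner0_self_eq_zero hδ key.1, eq_zero_of_inner0_self_eq_zero hd key.2⟩
  · apply eq_zero_of_inner1_self_eq_zero hδ
    rw [← inner2_dA1_left, ← lapA2, h]
    simp [inner2]
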